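/- Let m be even and let f : F_2^m → F_2^m be a weakly APN permutation with f(0) = 0. Then f has at most 2^(m-2) − 1 quadratic components, i.e. the number of nonzero v ∈ F_2^m with deg(⟨f, v⟩) ≤ 2 is at most 2^(m-2) − 1. -/

import Mathlib

/-- `F_2^m` as the space of binary vectors of length `m`. -/
abbrev BV (m : ℕ) := Fin m → ZMod 2

/-- The derivative of `f` in direction `a` : `f̂_a(x) = f(x+a) + f(x)`. -/
def der {m : ℕ} (f : BV m → BV m) (a : BV m) : BV m → BV m := fun x => f (x + a) + f x

/-- `f` is weakly APN: `|Im(f̂_a)| > 2^(m-2)` for all `a ≠ 0`. -/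
def WeakAPN {m : ℕ} (f : BV m → BV m) : Prop :=
  ∀ a : BV m, a ≠ 0 → 2 ^ (m - 2) < Nat.card (Set.range (der f a))

/-- Standard dot product over `F_2`; `⟨g, v⟩ = fun x => dotp v (g x)` is the `v`-component. -/
def dotp {m : ℕ} (v w : BV m) : ZMod 2 := ∑ i, v i * w i

/-- Algebraic degree of a Boolean function, via its algebraic normal form: the degree is the
maximal size of a monomial `∏_{i ∈ S} x_i` appearing with nonzero (Möbius) coefficient
`∑_{x : supp x ⊆ S} g x` in the unique reduced multilinear polynomial representing `g`. -/
def algDeg {m : ℕ} (g : BV m → ZMod 2) : ℕ :=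
  Finset.sup (Finset.univ.filter fun S : Finset (Fin m) =>
    (∑ x ∈ Finset.univ.filter (fun x : BV m => ∀ i, x i ≠ 0 → i ∈ S), g x) ≠ 0)
    Finset.card

/-- additive character -/
def chi (t : ZMod 2) : ℤ := if t = 0 then 1 else -1

lemma chi_add (s t : ZMod 2) : chi (s + t) = chi s * chi t := by
  revert s t; decide

lemma chi_zero : chi 0 = 1 := rfl

lemma chi_one : chi 1 = -1 := rfl

lemma zmod2_ne {s t : ZMod 2} (h : s ≠ t) : s + t = 1 := by
  revert s t; decide

lemma bv_add_self {m : ℕ} (a : BV m) : a + a = 0 := by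
  ext i
  exact CharTwo.add_self_eq_zero _

/-- quadratic functions -/
def Quad {m : ℕ} (g : BV m → ZMod 2) : Prop :=
  ∀ a b x, g (x + a + b) + g (x + a) + g (x + b) + g x = g (a + b) + g a + g b + g 0

/-- the coefficients -/
def coe2 {m : ℕ} (g : BV m → ZMod 2) (S : Finset (Fin m)) : ZMod 2 :=
  ∑ x ∈ Finset.univ.filter (fun x : BV m => ∀ i, x i ≠ 0 → i ∈ S), g x

lemma algDeg_le_iff {m : ℕ} (g : BV m → ZMod 2) :
    algDeg g ≤ 2 ↔ ∀ S : Finset (Fin m), 2 < S.card → coe2 g S = 0 := by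
  unfold algDeg coe2
  rw [Finset.sup_le_iff]
  constructor
  · intro h S hS
    by_contra hne
    have := h S (by simpa using hne)
    omega
  · intro h S hS
    by_contra hne
    have := h S (by omega)
    simp only [Finset.mem_filter] at hS
    exact hS.2 this

lemma coe2_add {m : ℕ} (g k : BV m → ZMod 2) (S : Finset (Fin m)) :
    coe2 (fun x => g x + k x) S = coe2 g S + coe2 k S := by
  unfold coe2
  exact Finset.sum_add_distrib

/-- support -/
def supp2 {m : ℕ} (x : BV m) : Finset (Fin m) := Finset.univ.filter fun i => x i ≠ 0

lemma supp2_inj {m : ℕ} {x y : BV m} (h : supp2 x = supp2 y) : x = y := by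
  ext i
  have h1 : i ∈ supp2 x ↔ i ∈ supp2 y := by rw [h]
  simp only [supp2, Finset.mem_filter, Finset.mem_univ, true_and] at h1
  revert h1
  generalize x i = s
  generalize y i = t
  revert s t
  decide

lemma prod_supp {m : ℕ} (x : BV m) (S : Finset (Fin m)) :
    ∏ i ∈ S, x i = if S ⊆ supp2 x then 1 else 0 := by
  split_ifs with h
  · apply Finset.prod_eq_one
    intro i hi
    have := h hi
    simp only [supp2, Finset.mem_filter, Finset.mem_univ, true_and] at this
    revert this
    generalize x i = s
    revert s
    decide
  · obtain ⟨i, hi, hn⟩ := Finset.not_subset.1 h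
    apply Finset.prod_eq_zero hi
    simpa [supp2] using hn

lemma anf {m : ℕ} (g : BV m → ZMod 2) (x : BV m) :
    g x = ∑ S : Finset (Fin m), coe2 g S * ∏ i ∈ S, x i := by
  have h1 : ∀ S : Finset (Fin m), coe2 g S * ∏ i ∈ S, x i
      = ∑ y : BV m, if S ∈ Finset.Icc (supp2 y) (supp2 x) then g y else 0 := by
    intro S
    rw [prod_supp, coe2, Finset.sum_filter]
    split_ifs with h
    · rw [mul_one]
      apply Finset.sum_congr rfl
      intro y _
      have : (∀ i, y i ≠ 0 → i ∈ S) ↔ S ∈ Finset.Icc (supp2 y) (supp2 x) := by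
        simp only [Finset.mem_Icc, h, and_true]
        simp [supp2, Finset.subset_iff]
      simp only [this]
    · rw [mul_zero]
      symm
      apply Finset.sum_eq_zero
      intro y _
      rw [if_neg]
      simp [h]
  simp_rw [h1]
  rw [Finset.sum_comm]
  rw [Finset.sum_eq_single x]
  · simp
  · intro y _ hy
    rw [← Finset.sum_filter, Finset.sum_const, Finset.filter_mem_eq_inter, Finset.univ_inter]
    by_cases hs : supp2 y ⊆ supp2 x
    · rw [Finset.card_Icc_finset hs]
      have hlt : (supp2 y).card < (supp2 x).card := by
        apply Finset.card_lt_card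
        refine Finset.ssubset_iff_subset_ne.2 ⟨hs, fun h => hy (supp2_inj h)⟩
      obtain ⟨k, hk⟩ : ∃ k, (supp2 x).card - (supp2 y).card = k + 1 :=
        ⟨(supp2 x).card - (supp2 y).card - 1, by omega⟩
      rw [hk, pow_succ, mul_smul, two_smul, CharTwo.add_self_eq_zero, smul_zero]
    · rw [Finset.Icc_eq_empty (by simpa using hs)]
      simp
  · simp

lemma quad_mono {m : ℕ} (S : Finset (Fin m)) (hS : S.card ≤ 2) :
    Quad (fun x : BV m => ∏ i ∈ S, x i) := by
  intro a b x
  have h3 : S.card = 0 ∨ S.card = 1 ∨ S.card = 2 := by omega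
  rcases h3 with h | h | h
  · rw [Finset.card_eq_zero] at h
    subst h
    simp
  · obtain ⟨i, rfl⟩ := Finset.card_eq_one.1 h
    simp only [Finset.prod_singleton, Pi.add_apply, Pi.zero_apply]
    generalize x i = s
    generalize a i = t
    generalize b i = r
    revert s t r
    decide
  · obtain ⟨i, j, hij, rfl⟩ := Finset.card_eq_two.1 h
    simp only [Finset.prod_pair hij, Pi.add_apply, Pi.zero_apply]
    generalize x i = s
    generalize a i = t
    generalize b i = r
    generalize x j = s'
    generalize a j = t'
    generalize b j = r'
    revert s t r s' t' r'
    decide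

lemma quad_of_deg {m : ℕ} (g : BV m → ZMod 2) (h : algDeg g ≤ 2) : Quad g := by
  rw [algDeg_le_iff] at h
  intro a b x
  have hg := anf g
  simp only [hg (x + a + b), hg (x + a), hg (x + b), hg x, hg (a + b), hg a, hg b, hg 0]
  simp only [← Finset.sum_add_distrib, ← mul_add]
  apply Finset.sum_congr rfl
  intro S _
  by_cases hS : S.card ≤ 2
  · rw [quad_mono S hS a b x]
  · rw [h S (by omega), zero_mul, zero_mul]

open Classical in
/-- linear structures -/
noncomputable def Rad {m : ℕ} (g : BV m → ZMod 2) : Finset (BV m) :=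
  Finset.univ.filter fun a => ∀ x, g (x + a) + g x = g a + g 0

/-- Walsh sum -/
def Wal {m : ℕ} (g : BV m → ZMod 2) : ℤ := ∑ x, chi (g x)

lemma mem_Rad {m : ℕ} (g : BV m → ZMod 2) (a : BV m) :
    a ∈ Rad g ↔ ∀ x, g (x + a) + g x = g a + g 0 := by
  simp [Rad]

lemma zero_mem_Rad {m : ℕ} (g : BV m → ZMod 2) : 0 ∈ Rad g := by
  rw [mem_Rad]; intro x
  rw [add_zero, CharTwo.add_self_eq_zero, CharTwo.add_self_eq_zero]

lemma der_sum {m : ℕ} (g : BV m → ZMod 2) (hg : Quad g) (a : BV m) (ha : a ∉ Rad g) :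
    ∑ x, chi (g (x + a) + g x) = 0 := by
  rw [mem_Rad] at ha
  push Not at ha
  obtain ⟨b, hb⟩ := ha
  have h1 := zmod2_ne hb
  have h2 : ∀ x, chi (g (x + b + a) + g (x + b)) = - chi (g (x + a) + g x) := by
    intro x
    have h3 := hg b a x
    have : g (x + b + a) + g (x + b) = (g (x + a) + g x) + 1 := by
      rw [← h1]
      revert h3
      generalize g (x + b + a) = a1
      generalize g (x + b) = a2
      generalize g (x + a) = a3
      generalize g x = a4
      generalize g (b + a) = a5
      generalize g b = a6
      generalize g a = a7
      generalize g 0 = a8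
      revert a1 a2 a3 a4 a5 a6 a7 a8
      decide
    rw [this, chi_add, chi_one]; ring
  have h4 : ∑ x, chi (g (x + b + a) + g (x + b)) = ∑ x, chi (g (x + a) + g x) :=
    Equiv.sum_comp (Equiv.addRight b) (fun x => chi (g (x + a) + g x))
  simp_rw [h2] at h4
  rw [Finset.sum_neg_distrib] at h4
  linarith

lemma wal_sq {m : ℕ} (g : BV m → ZMod 2) (hg : Quad g) :
    Wal g ^ 2 = 2 ^ m * ∑ a ∈ Rad g, chi (g a + g 0) := by
  have h1 : Wal g ^ 2 = ∑ a, ∑ x, chi (g (x + a) + g x) := by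
    rw [Finset.sum_comm, sq]
    unfold Wal
    rw [Finset.mul_sum]
    apply Finset.sum_congr rfl
    intro x _
    simp_rw [chi_add]
    rw [← Finset.sum_mul]
    congr 1
    exact (Equiv.sum_comp (Equiv.addLeft x) (fun y => chi (g y))).symm
  rw [h1, ← Finset.sum_subset (Finset.subset_univ (Rad g))
    (fun a _ ha => der_sum g hg a ha), Finset.mul_sum]
  apply Finset.sum_congr rfl
  intro a ha
  rw [mem_Rad] at ha
  simp_rw [ha]
  simp [ZMod.card]

lemma rad_add {m : ℕ} (g : BV m → ZMod 2) (a b : BV m) (ha : a ∈ Rad g) (hb : b ∈ Rad g) :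
    a + b ∈ Rad g ∧ g (a + b) + g 0 = (g a + g 0) + (g b + g 0) := by
  rw [mem_Rad] at *
  have key : ∀ x, g (x + (a + b)) + g x = (g a + g 0) + (g b + g 0) := by
    intro x
    rw [← ha x, ← hb (x + a), ← add_assoc]
    generalize g (x + a + b) = a1
    generalize g (x + a) = a2
    generalize g x = a3
    revert a1 a2 a3
    decide
  have k0 := key 0
  rw [zero_add] at k0
  exact ⟨fun x => by rw [key, k0], k0⟩

lemma wal_sq' {m : ℕ} (g : BV m → ZMod 2) (hg : Quad g) (h0 : Wal g ≠ 0) :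
    Wal g ^ 2 = 2 ^ m * (Rad g).card := by
  have h1 := wal_sq g hg
  rw [h1]
  congr 1
  have hne : ∑ a ∈ Rad g, chi (g a + g 0) ≠ 0 := by
    intro h
    rw [h, mul_zero] at h1
    exact h0 (pow_eq_zero_iff (two_ne_zero) |>.1 h1)
  have hone : ∀ b ∈ Rad g, chi (g b + g 0) = 1 := by
    intro b hb
    have h2 : ∑ a ∈ Rad g, chi (g (a + b) + g 0) = ∑ a ∈ Rad g, chi (g a + g 0) := by
      apply Finset.sum_bij' (fun a _ => a + b) (fun a _ => a + b)
      · intro a ha; exact (rad_add g a b ha hb).1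
      · intro a ha; exact (rad_add g a b ha hb).1
      · intro a _; rw [add_assoc, bv_add_self, add_zero]
      · intro a _; rw [add_assoc, bv_add_self, add_zero]
      · intro a _; rfl
    have h3 : ∑ a ∈ Rad g, chi (g (a + b) + g 0)
        = (∑ a ∈ Rad g, chi (g a + g 0)) * chi (g b + g 0) := by
      rw [Finset.sum_mul]
      apply Finset.sum_congr rfl
      intro a ha
      rw [(rad_add g a b ha hb).2, chi_add]
    rw [h3] at h2
    exact mul_left_cancel₀ hne (by rw [h2, mul_one])
  rw [Finset.sum_congr rfl hone]
  simp

lemma dotp_add_right {m : ℕ} (v x y : BV m) : dotp v (x + y) = dotp v x + dotp v y := by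
  simp [dotp, mul_add, Finset.sum_add_distrib]

lemma dotp_add_left {m : ℕ} (v x y : BV m) : dotp (x + y) v = dotp x v + dotp y v := by
  simp [dotp, add_mul, Finset.sum_add_distrib]

lemma dotp_comm {m : ℕ} (v x : BV m) : dotp v x = dotp x v := by
  simp [dotp, mul_comm]

lemma dotp_zero {m : ℕ} (v : BV m) : dotp v 0 = 0 := by
  simp [dotp]

lemma char_sum {m : ℕ} (v : BV m) (hv : v ≠ 0) : ∑ y, chi (dotp v y) = 0 := by
  obtain ⟨i, hi⟩ := Function.ne_iff.1 hv
  have h1 : dotp v (Pi.single i 1) = 1 := by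
    simp only [dotp, Pi.single_apply, mul_ite, mul_one, mul_zero, Finset.sum_ite_eq',
      Finset.mem_univ, if_true]
    simp only [Pi.zero_apply] at hi
    revert hi
    generalize v i = s
    revert s
    decide
  have h4 : ∑ x, chi (dotp v (x + Pi.single i 1)) = ∑ x, chi (dotp v x) :=
    Equiv.sum_comp (Equiv.addRight (Pi.single i 1)) (fun x => chi (dotp v x))
  simp_rw [dotp_add_right, chi_add, h1, chi_one] at h4
  rw [← Finset.sum_mul] at h4
  linarith

lemma wal_exists {m : ℕ} (g : BV m → ZMod 2) :
    ∃ u : BV m, Wal (fun x => g x + dotp u x) ≠ 0 := by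
  by_contra hcon
  push Not at hcon
  have h1 : ∑ u : BV m, Wal (fun x => g x + dotp u x) = 2 ^ m * chi (g 0) := by
    unfold Wal
    rw [Finset.sum_comm, Finset.sum_eq_single 0]
    · simp [dotp_zero]
    · intro x _ hx
      simp_rw [chi_add]
      rw [← Finset.mul_sum]
      simp_rw [fun u => dotp_comm u x]
      rw [char_sum x hx, mul_zero]
    · simp
  rw [Finset.sum_congr rfl (fun u _ => hcon u)] at h1
  have h2 : chi (g 0) ≠ 0 := by
    generalize g 0 = s
    revert s; decide
  simp [h2] at h1

lemma rad_card {m : ℕ} (hm : Even m) (g : BV m → ZMod 2) (hg : Quad g) (h0 : Wal g = 0) :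
    4 ≤ (Rad g).card := by
  obtain ⟨u, hu⟩ := wal_exists g
  have hq : Quad (fun x => g x + dotp u x) := by
    intro a b x
    have := hg a b x
    simp only [dotp_add_right, dotp_zero]
    have h2 : ∀ a1 a2 a3 a4 a5 a6 a7 a8 x a b : ZMod 2, a1 + a2 + a3 + a4 = a5 + a6 + a7 + a8 →
      a1 + (x + a + b) + (a2 + (x + a)) + (a3 + (x + b)) + (a4 + x)
        = a5 + (a + b) + (a6 + a) + (a7 + b) + (a8 + 0) := by
      intro a1 a2 a3 a4 a5 a6 a7 a8 x a b h
      have e : a1 + (x + a + b) + (a2 + (x + a)) + (a3 + (x + b)) + (a4 + x)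
        = (a1 + a2 + a3 + a4) + ((x + x) + (x + x) + (a + a) + (b + b)) := by ring
      have e' : a5 + (a + b) + (a6 + a) + (a7 + b) + (a8 + 0)
        = (a5 + a6 + a7 + a8) + ((a + a) + (b + b)) := by ring
      rw [e, e', h]
      simp only [CharTwo.add_self_eq_zero, add_zero]
    exact h2 _ _ _ _ _ _ _ _ _ _ _ this
  have hr : Rad (fun x => g x + dotp u x) = Rad g := by
    ext a
    simp only [mem_Rad, dotp_add_right, dotp_zero]
    apply forall_congr'
    intro x
    generalize g (x + a) = a1
    generalize g x = a2
    generalize g a = a3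
    generalize g 0 = a4
    generalize dotp u x = a5
    generalize dotp u a = a6
    revert a1 a2 a3 a4 a5 a6
    decide
  have hs := wal_sq' _ hq hu
  rw [hr] at hs
  obtain ⟨k, hk⟩ := hm
  have hne1 : (Rad g).card ≠ 1 := by
    intro h1
    obtain ⟨z, hz⟩ := Finset.card_eq_one.1 h1
    have h2 := zero_mem_Rad g
    rw [hz, Finset.mem_singleton] at h2
    have h3 := wal_sq g hg
    rw [hz, ← h2, h0, Finset.sum_singleton, CharTwo.add_self_eq_zero, chi_zero] at h3
    have h5 : (0 : ℤ) < 2 ^ m := by positivity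
    norm_num at h3
    omega
  have hne0 : (Rad g).card ≠ 0 := by
    have := Finset.card_pos.2 ⟨0, zero_mem_Rad g⟩
    omega
  set W := Wal (fun x => g x + dotp u x)
  have h2m : (2 : ℤ) ^ m = (2 ^ k) ^ 2 := by
    rw [hk]; ring
  have hdvd : (2 ^ k : ℤ) ∣ W := by
    rw [← Int.pow_dvd_pow_iff (two_ne_zero), hs]
    exact ⟨(Rad g).card, by rw [h2m]⟩
  obtain ⟨w, hw⟩ := hdvd
  have hsq : w ^ 2 = (Rad g).card := by
    have : (2 : ℤ) ^ m * w ^ 2 = 2 ^ m * (Rad g).card := by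
      rw [← hs, hw, h2m]; ring
    exact mul_left_cancel₀ (by positivity) this
  by_contra hlt
  push Not at hlt
  have h23 : (Rad g).card = 2 ∨ (Rad g).card = 3 := by omega
  have hw2 : w < 2 := by rcases h23 with h | h <;> rw [h] at hsq <;> push_cast at hsq <;> nlinarith
  have hw3 : -2 < w := by rcases h23 with h | h <;> rw [h] at hsq <;> push_cast at hsq <;> nlinarith
  have : w = -1 ∨ w = 0 ∨ w = 1 := by omega
  rcases h23 with h | h <;> rw [h] at hsq <;> rcases this with h | h | h <;> rw [h] at hsq <;>
    norm_num at hsq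

lemma codim_two {m : ℕ} (v w : BV m) (hv : v ≠ 0) (hw : w ≠ 0) (hvw : v ≠ w) (c d : ZMod 2) :
    4 * (Finset.univ.filter fun y : BV m => dotp v y = c ∧ dotp w y = d).card = 2 ^ m := by
  have hs : v + w ≠ 0 := by
    intro h
    apply hvw
    have : v + w + w = w := by rw [h, zero_add]
    rwa [add_assoc, bv_add_self, add_zero] at this
  have h1 : ∀ y : BV m, (4 : ℤ) * (if dotp v y = c ∧ dotp w y = d then 1 else 0)
      = 1 + chi c * chi (dotp v y) + chi d * chi (dotp w y)
        + chi c * chi d * chi (dotp (v + w) y) := by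
    intro y
    rw [dotp_add_left]
    generalize dotp v y = s
    generalize dotp w y = t
    revert c d s t
    decide
  have h2 : (4 : ℤ) * (Finset.univ.filter fun y : BV m => dotp v y = c ∧ dotp w y = d).card
      = 2 ^ m := by
    rw [Finset.card_filter]
    push_cast
    rw [Finset.mul_sum]
    simp_rw [h1]
    simp only [Finset.sum_add_distrib, ← Finset.mul_sum, char_sum v hv, char_sum w hw,
      char_sum _ hs]
    simp
  exact_mod_cast h2

lemma dotp_zero_left {m : ℕ} (v : BV m) : dotp 0 v = 0 := by
  simp [dotp]

/-- the subgroup of quadratic components -/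
def VS {m : ℕ} (f : BV m → BV m) : AddSubgroup (BV m) where
  carrier := {v | algDeg (fun x => dotp v (f x)) ≤ 2}
  zero_mem' := by
    simp only [Set.mem_ofPred_eq, algDeg_le_iff]
    intro S _
    simp [coe2, dotp_zero_left]
  add_mem' := by
    intro a b ha hb
    simp only [Set.mem_ofPred_eq, algDeg_le_iff] at *
    intro S hS
    simp_rw [dotp_add_left]
    rw [coe2_add, ha S hS, hb S hS, add_zero]
  neg_mem' := by
    intro a ha
    have : -a = a := neg_eq_of_add_eq_zero_left (bv_add_self a)
    rw [this]; exact ha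

theorem stmt_14 (m : ℕ) (hme : Even m) (f : BV m → BV m)
    (hperm : Function.Bijective f) (hf0 : f 0 = 0) (h : WeakAPN f) :
    Nat.card {v : BV m // v ≠ 0 ∧ algDeg (fun x => dotp v (f x)) ≤ 2} ≤ 2 ^ (m - 2) - 1 := by
  classical
  set Q : Finset (BV m) :=
    Finset.univ.filter fun v => v ≠ 0 ∧ algDeg (fun x => dotp v (f x)) ≤ 2 with hQ
  have hcard : Nat.card {v : BV m // v ≠ 0 ∧ algDeg (fun x => dotp v (f x)) ≤ 2} = Q.card := by
    rw [Nat.card_eq_fintype_card, Fintype.card_subtype]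
  have hVcard : Nat.card (VS f) = Q.card + 1 := by
    have e : Nat.card (VS f) = (insert 0 Q).card := by
      apply Nat.subtype_card
      intro v
      have hz := (VS f).zero_mem
      simp only [Finset.mem_insert, hQ, Finset.mem_filter,
        Finset.mem_univ, true_and]
      change v = 0 ∨ v ≠ 0 ∧ v ∈ VS f ↔ v ∈ VS f
      by_cases h0 : v = 0
      · simp [h0, hz]
      · simp [h0]
    rw [e, Finset.card_insert_of_notMem]
    simp [hQ]
  have hdvd : Q.card + 1 ∣ 2 ^ m := by
    rw [← hVcard]
    have := AddSubgroup.card_addSubgroup_dvd_card (VS f)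
    simpa [Nat.card_eq_fintype_card, ZMod.card] using this
  rw [hcard]
  by_contra hlt
  push Not at hlt
  have hm2 : 2 ≤ m := by
    by_contra hm
    have hm0 : m = 0 := by
      obtain ⟨k, hk⟩ := hme; omega
    subst hm0
    have : Q = ∅ := by
      apply Finset.eq_empty_of_forall_notMem
      intro v hv
      simp only [hQ, Finset.mem_filter] at hv
      exact hv.2.1 (Subsingleton.elim _ _)
    simp [this] at hlt
  have hP : 0 < 2 ^ (m - 2) := by positivity
  have hbig : 2 ^ (m - 1) ≤ Q.card + 1 := by
    obtain ⟨k, hk, he⟩ := (Nat.dvd_prime_pow Nat.prime_two).1 hdvd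
    rw [he]
    apply Nat.pow_le_pow_right (by norm_num)
    have : 2 ^ (m - 2) < 2 ^ k := by omega
    have := (Nat.pow_lt_pow_iff_right (by norm_num : 1 < 2)).1 this
    omega
  -- each quadratic component has at least three nonzero linear structures
  have hlow : ∀ v ∈ Q, 3 ≤ ((Rad fun x => dotp v (f x)).erase 0).card := by
    intro v hv
    simp only [hQ, Finset.mem_filter, Finset.mem_univ, true_and] at hv
    have h1 := rad_card hme (fun x => dotp v (f x)) (quad_of_deg _ hv.2) (by
      unfold Wal
      rw [← char_sum v hv.1]
      exact Function.Bijective.sum_comp hperm (fun y => chi (dotp v y)))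
    rw [Finset.card_erase_of_mem (zero_mem_Rad _)]
    omega
  have hup : ∀ a : BV m, a ≠ 0 →
      (Q.filter fun v => a ∈ Rad fun x => dotp v (f x)).card ≤ 1 := by
    intro a ha
    rw [Finset.card_le_one]
    intro v hv w hw
    by_contra hne
    simp only [hQ, Finset.mem_filter, Finset.mem_univ, true_and, mem_Rad] at hv hw
    have h4 := codim_two v w hv.1.1 hw.1.1 hne (dotp v (f a) + dotp v (f 0))
      (dotp w (f a) + dotp w (f 0))
    have h5 := h a ha
    have h6 : Nat.card (Set.range (der f a)) ≤ (Finset.univ.filter fun y : BV m =>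
        dotp v y = dotp v (f a) + dotp v (f 0) ∧ dotp w y = dotp w (f a) + dotp w (f 0)).card := by
      rw [Nat.card_coe_set_eq, ← Set.ncard_coe_finset]
      apply Set.ncard_le_ncard _ (Finset.finite_toSet _)
      rintro _ ⟨x, rfl⟩
      simp only [Finset.coe_filter, Finset.mem_univ, true_and, Set.mem_ofPred_eq, der,
        dotp_add_right]
      exact ⟨hv.2 x, hw.2 x⟩
    obtain ⟨j, rfl⟩ : ∃ j, m = j + 2 := ⟨m - 2, by omega⟩
    simp only [Nat.add_sub_cancel] at h5
    rw [pow_add] at h4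
    omega
  have hcount : 3 * Q.card ≤ 2 ^ m - 1 := by
    calc 3 * Q.card = ∑ v ∈ Q, 3 := by simp [mul_comm]
      _ ≤ ∑ v ∈ Q, ((Rad fun x => dotp v (f x)).erase 0).card := Finset.sum_le_sum hlow
      _ = ∑ v ∈ Q, (((Finset.univ : Finset (BV m)).erase 0).filter
            fun a => a ∈ Rad fun x => dotp v (f x)).card := by
          apply Finset.sum_congr rfl
          intro v _
          congr 1
          ext a
          simp
      _ = ∑ a ∈ (Finset.univ : Finset (BV m)).erase 0,
            (Q.filter fun v => a ∈ Rad fun x => dotp v (f x)).card := by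
          simp_rw [Finset.card_filter]
          rw [Finset.sum_comm]
      _ ≤ ∑ a ∈ (Finset.univ : Finset (BV m)).erase 0, 1 := by
          apply Finset.sum_le_sum
          intro a ha
          exact hup a (Finset.ne_of_mem_erase ha)
      _ = 2 ^ m - 1 := by
          simp [ZMod.card]
  have hm' : m = 2 := by
    by_contra hne
    obtain ⟨j, rfl⟩ : ∃ j, m = j + 3 := ⟨m - 3, by omega⟩
    have e1 : 2 ^ (j + 3 - 1) = 4 * 2 ^ j := by
      rw [show j + 3 - 1 = j + 2 from rfl, pow_add]; ring
    have e2 : 2 ^ (j + 3) = 8 * 2 ^ j := by rw [pow_add]; ring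
    have : 0 < 2 ^ j := by positivity
    omega
  subst hm'
  have hall : Q = (Finset.univ : Finset (BV 2)).erase 0 := by
    ext v
    simp only [hQ, Finset.mem_filter, Finset.mem_univ, true_and, Finset.mem_erase, and_true,
      and_iff_left_iff_imp]
    intro _
    rw [algDeg_le_iff]
    intro S hS
    have := Finset.card_le_univ S
    simp at this
    omega
  rw [hall] at hcount
  simp [ZMod.card] at hcount
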